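/- Let p be a prime, and let ℕ[1/p] = {a/p^k : a ∈ ℕ, k ≥ 0} ⊆ ℚ≥0. Let P be an integral, saturated, sharp commutative monoid admitting a surjective monoid homomorphism ℕ[1/p]^n → P. Then the group completion P^gp is a free ℤ[1/p]-module of rank at most n. -/

import Mathlib

/-- The additive submonoid `ℕ[1/p] = {a / p^k : a ∈ ℕ, k ≥ 0}` of `ℚ`
(for `p` prime this is exactly the set of nonnegative rationals whose
denominator is a power of `p`). -/
def nLoc (p : ℕ) : AddSubmonoid ℚ where
  carrier := {q : ℚ | ∃ (a : ℕ) (k : ℕ), q * (p : ℚ) ^ k = (a : ℚ)}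
  zero_mem' := ⟨0, 0, by norm_num⟩
  add_mem' := by
    rintro x y ⟨a, k, ha⟩ ⟨b, l, hb⟩
    refine ⟨a * p ^ l + b * p ^ k, k + l, ?_⟩
    push_cast
    rw [pow_add]
    calc (x + y) * ((p : ℚ) ^ k * (p : ℚ) ^ l)
        = x * (p : ℚ) ^ k * (p : ℚ) ^ l + y * (p : ℚ) ^ l * (p : ℚ) ^ k := by ring
      _ = (a : ℚ) * (p : ℚ) ^ l + (b : ℚ) * (p : ℚ) ^ k := by rw [ha, hb]

/-- The additive subgroup `ℤ[1/p] = {a / p^k : a ∈ ℤ, k ≥ 0}` of `ℚ`;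
this is the group completion of `ℕ[1/p]`. -/
def zLoc (p : ℕ) : AddSubgroup ℚ where
  carrier := {q : ℚ | ∃ (a : ℤ) (k : ℕ), q * (p : ℚ) ^ k = (a : ℚ)}
  zero_mem' := ⟨0, 0, by norm_num⟩
  add_mem' := by
    rintro x y ⟨a, k, ha⟩ ⟨b, l, hb⟩
    refine ⟨a * p ^ l + b * p ^ k, k + l, ?_⟩
    push_cast
    rw [pow_add]
    calc (x + y) * ((p : ℚ) ^ k * (p : ℚ) ^ l)
        = x * (p : ℚ) ^ k * (p : ℚ) ^ l + y * (p : ℚ) ^ l * (p : ℚ) ^ k := by ring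
      _ = (a : ℚ) * (p : ℚ) ^ l + (b : ℚ) * (p : ℚ) ^ k := by rw [ha, hb]
  neg_mem' := by
    rintro x ⟨a, k, ha⟩
    exact ⟨-a, k, by push_cast; rw [neg_mul, ha]⟩

/-- The ring structure on `ℤ[1/p]`, as a subring of `ℚ`. -/
def zLocSubring (p : ℕ) : Subring ℚ where
  __ := zLoc p
  one_mem' := ⟨1, 0, by norm_num⟩
  mul_mem' := by
    rintro x y ⟨a, k, ha⟩ ⟨b, l, hb⟩
    refine ⟨a * b, k + l, ?_⟩
    push_cast
    rw [← ha, ← hb]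
    ring

lemma zLocSubring_exists_mul_pow {p : ℕ} (r : zLocSubring p) :
    ∃ (a : ℤ) (k : ℕ), r * (p : zLocSubring p) ^ k = (a : zLocSubring p) := by
  obtain ⟨x, a, k, h⟩ := r
  exact ⟨a, k, Subtype.ext (by simpa using h)⟩

lemma zLocSubring_isUnit {p : ℕ} (hp : p ≠ 0) : IsUnit (p : zLocSubring p) := by
  have hp' : (p : ℚ) ≠ 0 := by exact_mod_cast hp
  refine IsUnit.of_mul_eq_one ⟨(p : ℚ)⁻¹, 1, 1, by simp [hp']⟩ (Subtype.ext ?_)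
  simp [hp']

lemma zLocSubring_isPrincipalIdealRing {p : ℕ} (hp : p ≠ 0) :
    IsPrincipalIdealRing (zLocSubring p) where
  principal I := by
    obtain ⟨d, hd⟩ := IsPrincipalIdealRing.principal (I.comap (Int.castRingHom (zLocSubring p)))
    refine ⟨(d : zLocSubring p), le_antisymm (fun x hx => ?_) ?_⟩
    · obtain ⟨a, k, h⟩ := zLocSubring_exists_mul_pow x
      have ha : a ∈ I.comap (Int.castRingHom (zLocSubring p)) := by
        simpa [Ideal.mem_comap, ← h] using I.mul_mem_right _ hx
      rw [hd] at ha
      obtain ⟨c, rfl⟩ := Ideal.mem_span_singleton.1 ha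
      refine Ideal.mem_span_singleton.2 ?_
      rw [← ((zLocSubring_isUnit hp).pow k).dvd_mul_right, h]
      exact ⟨(c : zLocSubring p), by push_cast; rfl⟩
    · rw [Submodule.span_singleton_le_iff_mem]
      have : d ∈ I.comap (Int.castRingHom (zLocSubring p)) := by
        rw [hd]; exact Submodule.mem_span_singleton_self d
      simpa using this

/-- A torsion-free quotient group of `ℤ[1/p]^n` is free over `ℤ[1/p]` of rank at most `n`. -/
lemma exists_addEquiv_of_surjective {p : ℕ} (hp : p ≠ 0) {n : ℕ} {G : Type*} [AddCommGroup G]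
    [IsAddTorsionFree G] (F : (Fin n → zLocSubring p) →+ G) (hF : Function.Surjective F) :
    ∃ m : ℕ, m ≤ n ∧ Nonempty (G ≃+ (Fin m → zLocSubring p)) := by
  have := zLocSubring_isPrincipalIdealRing hp
  have key (r : zLocSubring p) (v : Fin n → zLocSubring p) {a : ℤ} {k : ℕ}
      (h : r * (p : zLocSubring p) ^ k = (a : zLocSubring p)) :
      (p ^ k) • F (r • v) = a • F v := by
    rw [← map_nsmul, ← map_zsmul]
    congr 1
    ext1 i
    simp only [Pi.smul_apply, smul_eq_mul, nsmul_eq_mul, zsmul_eq_mul, ← h]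
    push_cast
    ring
  let N : Submodule (zLocSubring p) (Fin n → zLocSubring p) :=
    { F.ker with
      smul_mem' := fun r v hv => by
        obtain ⟨a, k, h⟩ := zLocSubring_exists_mul_pow r
        have hv : F v = 0 := hv
        have := key r v h
        rw [hv, smul_zero] at this
        exact (nsmul_eq_zero_iff_right (pow_ne_zero k hp)).1 this }
  have hN (v) : v ∈ N ↔ F v = 0 := Iff.rfl
  have : Module.IsTorsionFree (zLocSubring p) ((Fin n → zLocSubring p) ⧸ N) := by
    refine .of_smul_eq_zero fun r x hx => ?_
    obtain ⟨v, rfl⟩ := N.mkQ_surjective x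
    rw [← map_smul, N.mkQ_apply, Submodule.Quotient.mk_eq_zero, hN] at hx
    rw [N.mkQ_apply, Submodule.Quotient.mk_eq_zero, hN]
    obtain ⟨a, k, h⟩ := zLocSubring_exists_mul_pow r
    have hk := key r v h
    rw [hx, smul_zero, eq_comm, smul_eq_zero] at hk
    refine hk.imp_left fun ha => ?_
    rw [ha, Int.cast_zero] at h
    exact ((zLocSubring_isUnit hp).pow k).mul_left_eq_zero.1 h
  refine ⟨Module.finrank (zLocSubring p) ((Fin n → zLocSubring p) ⧸ N), ?_, ⟨?_⟩⟩
  · simpa using Submodule.finrank_quotient_le N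
  · exact (QuotientAddGroup.quotientKerEquivOfSurjective F hF).symm.trans
      (Module.finBasis (zLocSubring p) ((Fin n → zLocSubring p) ⧸ N)).equivFun.toAddEquiv

lemma exists_eq_sub_nLoc {p : ℕ} (hp : p ≠ 0) (r : zLocSubring p) :
    ∃ a b : nLoc p, (r : ℚ) = a - b := by
  obtain ⟨x, c, k, h⟩ := r
  have hp' : (p : ℚ) ^ k ≠ 0 := by positivity
  refine ⟨⟨c.toNat / (p : ℚ) ^ k, c.toNat, k, by field_simp⟩,
    ⟨(-c).toNat / (p : ℚ) ^ k, (-c).toNat, k, by field_simp⟩, ?_⟩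
  have hc : ((c.toNat : ℤ) : ℚ) - (((-c).toNat : ℤ) : ℚ) = c := by
    exact_mod_cast Int.toNat_sub_toNat_neg c
  push_cast at hc
  rw [← sub_div, hc]
  exact (eq_div_iff hp').2 h

/-- The extension of a homomorphism on `ℕ[1/p]^n` to the group completion `ℤ[1/p]^n`. -/
lemma exists_extension_zLocSubring {p : ℕ} (hp : p ≠ 0) {n : ℕ} {G : Type*} [AddCommGroup G]
    (g : (Fin n → nLoc p) →+ G) :
    ∃ F : (Fin n → zLocSubring p) →+ G, ∀ v a b,
      (∀ i, (v i : ℚ) = (a i : ℚ) - b i) → F v = g a - g b := by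
  choose s t hst using exists_eq_sub_nLoc hp
  have key (v : Fin n → zLocSubring p) (a b : Fin n → nLoc p)
      (h : ∀ i, (v i : ℚ) = (a i : ℚ) - b i) :
      g (s ∘ v) - g (t ∘ v) = g a - g b := by
    rw [sub_eq_sub_iff_add_eq_add, ← map_add, ← map_add]
    congr 1
    ext i
    have := h i
    rw [hst] at this
    simp only [Pi.add_apply, Function.comp_apply, AddSubmonoid.coe_add]
    linarith
  refine ⟨AddMonoidHom.mk' (fun v => g (s ∘ v) - g (t ∘ v)) fun v w => ?_, key⟩
  rw [key (v + w) (s ∘ v + s ∘ w) (t ∘ v + t ∘ w), map_add, map_add]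
  · abel
  · intro i
    simp [hst (v i), hst (w i)]
    ring

lemma isAddTorsionFree_of_saturated_of_sharp {P G : Type*} [AddCommMonoid P] [AddCommGroup G]
    (ι : P →+ G) (hinj : Function.Injective ι)
    (hsat : ∀ x : G, (∃ m : ℕ, 1 ≤ m ∧ m • x ∈ Set.range ι) → x ∈ Set.range ι)
    (hsharp : ∀ a b : P, a + b = 0 → a = 0 ∧ b = 0) : IsAddTorsionFree G := by
  refine ⟨fun m hm x y hxy => ?_⟩
  have h : m • (x - y) = 0 := by simpa [smul_sub, sub_eq_zero] using hxy
  have h0 : (0 : G) ∈ Set.range ι := ⟨0, map_zero ι⟩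
  obtain ⟨a, ha⟩ := hsat (x - y) ⟨m, Nat.one_le_iff_ne_zero.2 hm, h ▸ h0⟩
  obtain ⟨b, hb⟩ := hsat (-(x - y)) ⟨m, Nat.one_le_iff_ne_zero.2 hm, by
    rwa [smul_neg, h, neg_zero]⟩
  have hab : a + b = 0 := hinj (by rw [map_add, ha, hb, add_neg_cancel, map_zero])
  rw [← sub_eq_zero, ← ha, (hsharp a b hab).1, map_zero]

/-- Let `p` be a prime and `P` an integral, saturated, sharp commutative
monoid admitting a surjective monoid homomorphism `ℕ[1/p]^n → P`.  Then the group
completion `P^gp` (encoded by `ι : P →+ G` injective with image generating `G` by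
differences) is a free `ℤ[1/p]`-module of rank at most `n`, i.e. it is isomorphic
(as an additive group) to `(ℤ[1/p])^m` for some `m ≤ n`. -/
theorem stmt1 {p : ℕ} (hp : p.Prime) {n : ℕ}
    {P G : Type*} [AddCommMonoid P] [AddCommGroup G]
    (ι : P →+ G) (hinj : Function.Injective ι)
    (hgen : ∀ x : G, ∃ a b : P, x = ι a - ι b)
    (hsat : ∀ x : G, (∃ m : ℕ, 1 ≤ m ∧ m • x ∈ Set.range ι) → x ∈ Set.range ι)
    (hsharp : ∀ a b : P, a + b = 0 → a = 0 ∧ b = 0)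
    (f : (Fin n → ↥(nLoc p)) →+ P) (hf : Function.Surjective f) :
    ∃ m : ℕ, m ≤ n ∧ Nonempty (G ≃+ (Fin m → ↥(zLoc p))) := by
  have := isAddTorsionFree_of_saturated_of_sharp ι hinj hsat hsharp
  obtain ⟨F, hF⟩ := exists_extension_zLocSubring hp.ne_zero (ι.comp f)
  refine exists_addEquiv_of_surjective hp.ne_zero F fun x => ?_
  obtain ⟨a, b, rfl⟩ := hgen x
  obtain ⟨u, rfl⟩ := hf a
  obtain ⟨v, rfl⟩ := hf b
  have hle : ∀ q ∈ nLoc p, q ∈ zLocSubring p := by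
    rintro q ⟨c, k, h⟩
    exact ⟨c, k, by simpa using h⟩
  exact ⟨fun i => ⟨u i - v i, sub_mem (hle _ (u i).2) (hle _ (v i).2)⟩,
    hF _ u v fun _ => rfl⟩
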